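/- arXiv:1504.03175 — 4 statements merged into one kernel-verified Lean document; each statement's English description precedes it below -/
import Mathlib

section
/- Let s ≥ 1, let f ∈ L¹([0,1)^s), let k ∈ ℕ₀^s with k_i = ∑_{j=1}^{N_i} 2^{a_{i,j}}, a_{i,1} > ⋯ > a_{i,N_i} ≥ 0, and let u ∈ ℕ^s. Let d_{k_u} f denote the composition, over all i with k_i ≠ 0 and all 1 ≤ j ≤ min(u_i, N_i), of the dyadic differences ∂_{i, a_{i,j}+1} applied to f (the order is irrelevant since dyadic differences commute). Then d_{k_u} f ∈ L¹([0,1)^s) and f̂(k) = (−1)^{∑_{i=1}^s min(u_i,N_i)} · 2^{−μ'_u(k)} · (d_{k_u} f)^̂(k). -/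
open MeasureTheory Finset
open scoped ENNReal

noncomputable section

/-- The `j`-th binary digit (`j ≥ 1`) of a real number `x ∈ [0,1)`
(using the binary expansion in which infinitely many digits are `0`). -/
def bdigit (x : ℝ) (j : ℕ) : ℕ := ⌊x * 2 ^ j⌋.toNat % 2

/-- The `k`-th (dyadic) Walsh function. -/
def walsh (k : ℕ) (x : ℝ) : ℝ :=
  (-1 : ℝ) ^ (∑ j ∈ Finset.range k, if k.testBit j then bdigit x (j + 1) else 0)

/-- The multi-dimensional Walsh function. -/
def walshV {s : ℕ} (k : Fin s → ℕ) (x : Fin s → ℝ) : ℝ := ∏ i, walsh (k i) (x i)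

/-- The half-open unit cube `[0,1)^s`. -/
def unitCube (s : ℕ) : Set (Fin s → ℝ) := Set.univ.pi fun _ => Set.Ico (0 : ℝ) 1

/-- The closed unit cube `[0,1]^s`. -/
def closedCube (s : ℕ) : Set (Fin s → ℝ) := Set.univ.pi fun _ => Set.Icc (0 : ℝ) 1

/-- The `k`-th Walsh coefficient of `f`. -/
def walshCoeff {s : ℕ} (f : (Fin s → ℝ) → ℝ) (k : Fin s → ℕ) : ℝ :=
  ∫ x in unitCube s, f x * walshV k x

/-- `z ⊕ 2^{-n}` : flipping the `n`-th binary digit of `z`. -/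
def oplus (z : ℝ) (n : ℕ) : ℝ := z + (-1) ^ bdigit z n * ((2 : ℝ) ^ n)⁻¹

/-- The dyadic difference `∂_{i,n}`. -/
def dyadicDiff {s : ℕ} (i : Fin s) (n : ℕ) (g : (Fin s → ℝ) → ℝ) (x : Fin s → ℝ) : ℝ :=
  2 ^ n * (g (Function.update x i (oplus (x i) n)) - g x)

/-- The function `χ_n`. -/
def chi (n : ℕ) (x y : ℝ) : ℝ :=
  if min x (oplus x n) ≤ y ∧ y ≤ max x (oplus x n) then 2 ^ n else 0

/-- The exponents in the binary expansion of `k`, in decreasing order. -/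
def bitsDesc (k : ℕ) : List ℕ := ((List.range k).filter fun j => k.testBit j).reverse

/-- The number `N` of nonzero binary digits of `k`. -/
def numBits (k : ℕ) : ℕ := (bitsDesc k).length

/-- The weight `μ'_u(k) = ∑_{j=1}^{min(u,N)} (a_j + 2)` for scalar `k`. -/
def muW (u k : ℕ) : ℕ := (((bitsDesc k).take u).map (· + 2)).sum

/-- The weight `μ'_u(k)` for vectors. -/
def muWV {s : ℕ} (u k : Fin s → ℕ) : ℕ := ∑ i, muW (u i) (k i)

/-- `k_{≤}^{u}` : the `u` most significant binary digits of `k`. -/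
def kLe (u k : ℕ) : ℕ := (((bitsDesc k).take u).map (2 ^ ·)).sum

/-- `k_{>}^{u}` : the remaining binary digits of `k`. -/
def kGt (u k : ℕ) : ℕ := (((bitsDesc k).drop u).map (2 ^ ·)).sum

/-- The functions `W(k)`, defined inductively by stripping the least significant
binary digit of `k` (whose exponent is the 2-adic valuation of `k`). -/
def Wfun : ℕ → ℝ → ℝ
  | 0 => fun _ => 1
  | (k + 1) => fun y =>
      ∫ x in Set.Ico (0 : ℝ) 1,
        chi ((k + 1).factorization 2 + 1) x y *
          Wfun ((k + 1) - 2 ^ ((k + 1).factorization 2)) x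
  decreasing_by exact Nat.sub_lt (Nat.succ_pos k) (Nat.two_pow_pos _)

/-- Composition of the dyadic differences `∂_{i,a+1}` for `a` running over a list. -/
def dCompCoord {s : ℕ} (i : Fin s) (L : List ℕ) (g : (Fin s → ℝ) → ℝ) : (Fin s → ℝ) → ℝ :=
  L.foldr (fun a h => dyadicDiff i (a + 1) h) g

/-- The operator `d_{k_u}` : composition over all coordinates `i` of the dyadic
differences `∂_{i,a_{i,j}+1}`, `1 ≤ j ≤ min(u_i, N_i)`. -/
def dComp {s : ℕ} (u k : Fin s → ℕ) (f : (Fin s → ℝ) → ℝ) : (Fin s → ℝ) → ℝ :=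
  (List.finRange s).foldr (fun i g => dCompCoord i ((bitsDesc (k i)).take (u i)) g) f

/-- The multi-index `ν` increased by one in coordinate `i`. -/
def addE {s : ℕ} (i : Fin s) (ν : Fin s → ℕ) : Fin s → ℕ := Function.update ν i (ν i + 1)

/-- `D` is a family of mixed partial derivatives of `f`, of orders up to `u_i` in
the variable `x_i`, each continuous on the closed cube `[0,1]^s`. -/
def HasMixedDerivs {s : ℕ} (u : Fin s → ℕ) (f : (Fin s → ℝ) → ℝ)
    (D : (Fin s → ℕ) → (Fin s → ℝ) → ℝ) : Prop :=
  D (fun _ => 0) = f ∧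
    (∀ ν : Fin s → ℕ, (∀ j, ν j ≤ u j) → ContinuousOn (D ν) (closedCube s)) ∧
    ∀ (ν : Fin s → ℕ) (i : Fin s), (∀ j, addE i ν j ≤ u j) →
      ∀ x ∈ closedCube s,
        HasDerivWithinAt (fun t => D ν (Function.update x i t)) (D (addE i ν) x)
          (Set.Icc 0 1) (x i)

/-- `∫_{[0,1)^{s-|v|}} F dx_{S∖v}` : the inner integral over the coordinates outside `v`
(as a function of the coordinates in `v`). -/
def projInt {s : ℕ} (v : Finset (Fin s)) (F : (Fin s → ℝ) → ℝ) (x : Fin s → ℝ) : ℝ :=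
  ∫ y in unitCube s, F fun i => if i ∈ v then x i else y i

/-- The mixed norm `‖F^{(·)}‖_p` : the `L^p` norm (over the coordinates in `v`) of the
integral of `F` over the coordinates outside `v`. -/
def mixedNorm {s : ℕ} (p : ℝ≥0∞) (v : Finset (Fin s)) (F : (Fin s → ℝ) → ℝ) : ℝ≥0∞ :=
  eLpNorm (projInt v F) p (volume.restrict (unitCube s))

/-- The `ℓ^q` norm of a finite family in `ℝ≥0∞`, with the usual modification at `q = ∞`. -/
def lqNorm {ι : Type*} [Fintype ι] (q : ℝ≥0∞) (a : ι → ℝ≥0∞) : ℝ≥0∞ :=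
  if q = ∞ then ⨆ i, a i else (∑ i, a i ^ q.toReal) ^ q.toReal⁻¹

/-- The `h`-th point of the digital net generated by the matrices `C i`. -/
def netPoint {s m n : ℕ} (C : Fin s → Matrix (Fin n) (Fin m) (ZMod 2)) (h : Fin (2 ^ m)) :
    Fin s → ℝ :=
  fun i => ∑ j : Fin n,
    (((∑ l : Fin m, (if (h : ℕ).testBit (l : ℕ) then (1 : ZMod 2) else 0) * C i j l).val : ℝ) *
      ((2 : ℝ) ^ ((j : ℕ) + 1))⁻¹)

/-- Membership of `k ∈ ℕ₀^s` in the dual net `P^⊥`. -/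
def inDual {s m n : ℕ} (C : Fin s → Matrix (Fin n) (Fin m) (ZMod 2)) (k : Fin s → ℕ) : Prop :=
  ∀ l : Fin m, ∑ i, ∑ j : Fin n, C i j l * (if (k i).testBit (j : ℕ) then (1 : ZMod 2) else 0) = 0

open Classical in
/-- `∑_{k_v ∈ P_v^⊥} 2^{-μ'_α(k_v)}`, encoded as a sum over all `k ∈ ℕ₀^s`
with support exactly `v` lying in the dual net. -/
def dualSum {s m n : ℕ} (α : ℕ) (C : Fin s → Matrix (Fin n) (Fin m) (ZMod 2))
    (v : Finset (Fin s)) : ℝ≥0∞ :=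
  ∑' k : Fin s → ℕ,
    if (∀ i, i ∈ v ↔ k i ≠ 0) ∧ inDual C k
    then (2 : ℝ≥0∞) ^ (-(muWV (fun _ => α) k : ℝ)) else 0


lemma bdigit_eq_floor (x : ℝ) (j : ℕ) : bdigit x j = ⌊x * 2 ^ j⌋₊ % 2 := by
  rw [bdigit, Int.floor_toNat]

lemma bdigit_eq_zero_or_one (x : ℝ) (j : ℕ) : bdigit x j = 0 ∨ bdigit x j = 1 :=
  Nat.mod_two_eq_zero_or_one _

lemma measurable_bdigit (j : ℕ) : Measurable fun x : ℝ => bdigit x j := by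
  unfold bdigit
  exact (measurable_of_countable fun m : ℤ => m.toNat % 2).comp
    (Int.measurable_floor.comp (measurable_id.mul_const _))

lemma measurable_oplus (n : ℕ) : Measurable fun x : ℝ => oplus x n := by
  unfold oplus
  exact measurable_id.add
    (((measurable_of_countable fun m : ℕ => (-1 : ℝ) ^ m).comp (measurable_bdigit n)).mul_const _)

lemma floor_mul_two_pow_of_le (y : ℝ) {j n : ℕ} (hj : j ≤ n) :
    ⌊y * 2 ^ j⌋₊ = ⌊y * 2 ^ n⌋₊ / 2 ^ (n - j) := by
  obtain ⟨d, rfl⟩ := Nat.exists_eq_add_of_le hj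
  rw [← Nat.floor_div_natCast]
  congr 1
  push_cast
  rw [Nat.add_sub_cancel_left, pow_add]
  field_simp

lemma oplus_mul_two_pow (x : ℝ) (n d : ℕ) :
    oplus x n * 2 ^ (n + d) = x * 2 ^ (n + d) + (-1) ^ bdigit x n * 2 ^ d := by
  unfold oplus
  rw [pow_add]
  field_simp

lemma floor_sub_two_pow (z : ℝ) (d : ℕ) : ⌊z - 2 ^ d⌋₊ = ⌊z⌋₊ - 2 ^ d := by
  have := Nat.floor_sub_natCast z (2 ^ d)
  push_cast at this
  exact this

lemma floor_add_two_pow {z : ℝ} (hz : 0 ≤ z) (d : ℕ) : ⌊z + 2 ^ d⌋₊ = ⌊z⌋₊ + 2 ^ d := by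
  have := Nat.floor_add_natCast hz (2 ^ d)
  push_cast at this
  exact this

lemma two_pow_le_of_bdigit_eq_one {x : ℝ} {n : ℕ} (h : bdigit x n = 1) (d : ℕ) :
    (2 : ℝ) ^ d ≤ x * 2 ^ (n + d) := by
  have h1 : 1 ≤ ⌊x * 2 ^ n⌋₊ := by
    rw [bdigit_eq_floor] at h
    omega
  have h2 : (1 : ℝ) ≤ x * 2 ^ n := by
    simpa using (Nat.le_floor_iff' one_ne_zero).1 h1
  rw [pow_add, ← mul_assoc]
  exact le_mul_of_one_le_left (by positivity) h2

lemma oplus_nonneg {x : ℝ} (hx : 0 ≤ x) (n : ℕ) : 0 ≤ oplus x n := by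
  rcases bdigit_eq_zero_or_one x n with h | h
  · rw [oplus, h]
    positivity
  · have h2 := two_pow_le_of_bdigit_eq_one h 0
    have h3 := oplus_mul_two_pow x n 0
    rw [h] at h3
    have : 0 ≤ oplus x n * 2 ^ (n + 0) := by rw [h3]; linarith
    exact nonneg_of_mul_nonneg_left this (by positivity)

lemma floor_oplus_mul {x : ℝ} (hx : 0 ≤ x) (n d : ℕ) :
    ⌊oplus x n * 2 ^ (n + d)⌋₊ =
      if bdigit x n = 0 then ⌊x * 2 ^ (n + d)⌋₊ + 2 ^ d else ⌊x * 2 ^ (n + d)⌋₊ - 2 ^ d := by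
  rw [oplus_mul_two_pow]
  rcases bdigit_eq_zero_or_one x n with h | h
  · simp only [h, pow_zero, one_mul, if_true]
    exact floor_add_two_pow (by positivity) d
  · simp only [h, pow_one, one_ne_zero, if_false, neg_one_mul, ← sub_eq_add_neg]
    exact floor_sub_two_pow _ d

lemma bdigit_oplus_self {x : ℝ} (hx : 0 ≤ x) (n : ℕ) :
    bdigit (oplus x n) n = 1 - bdigit x n := by
  have h := floor_oplus_mul hx n 0
  simp only [add_zero, pow_zero] at h
  rw [bdigit_eq_floor, h]
  simp only [bdigit_eq_floor]
  split_ifs <;> omega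

lemma floor_oplus_of_lt {x : ℝ} (hx : 0 ≤ x) {j n : ℕ} (hj : j < n) :
    ⌊oplus x n * 2 ^ j⌋₊ = ⌊x * 2 ^ j⌋₊ := by
  rw [floor_mul_two_pow_of_le _ hj.le, floor_mul_two_pow_of_le x hj.le]
  have h := floor_oplus_mul hx n 0
  simp only [add_zero, pow_zero] at h
  obtain ⟨e, he⟩ : ∃ e, n - j = 1 + e := ⟨n - j - 1, by omega⟩
  rw [h, he, pow_add, pow_one, ← Nat.div_div_eq_div_mul, ← Nat.div_div_eq_div_mul]
  congr 1
  simp only [bdigit_eq_floor]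
  split_ifs <;> omega

lemma bdigit_oplus_of_ne {x : ℝ} (hx : 0 ≤ x) {j n : ℕ} (hj : j ≠ n) :
    bdigit (oplus x n) j = bdigit x j := by
  rw [bdigit_eq_floor, bdigit_eq_floor]
  rcases hj.lt_or_gt with h | h
  · rw [floor_oplus_of_lt hx h]
  · obtain ⟨d, rfl⟩ := Nat.exists_eq_add_of_lt h
    rw [add_assoc, floor_oplus_mul hx]
    have h2 : 2 ^ (d + 1) = 2 * 2 ^ d := pow_succ' 2 d
    split_ifs with h0
    · omega
    · have h1 := (bdigit_eq_zero_or_one x n).resolve_left h0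
      have h3 : 2 ^ (d + 1) ≤ ⌊x * 2 ^ (n + (d + 1))⌋₊ := by
        apply Nat.le_floor
        exact_mod_cast two_pow_le_of_bdigit_eq_one h1 (d + 1)
      omega

lemma oplus_mem_Ico {x : ℝ} (hx : x ∈ Set.Ico (0 : ℝ) 1) {n : ℕ} (hn : 0 < n) :
    oplus x n ∈ Set.Ico (0 : ℝ) 1 := by
  refine ⟨oplus_nonneg hx.1 n, ?_⟩
  have h := floor_oplus_of_lt hx.1 hn
  rw [pow_zero, mul_one, mul_one, Nat.floor_eq_zero.2 hx.2] at h
  exact Nat.floor_eq_zero.1 h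

lemma oplus_of_bdigit_eq_zero {x : ℝ} {n : ℕ} (h : bdigit x n = 0) :
    oplus x n = x + ((2 : ℝ) ^ n)⁻¹ := by
  simp [oplus, h]

lemma oplus_of_bdigit_eq_one {x : ℝ} {n : ℕ} (h : bdigit x n = 1) :
    oplus x n = x - ((2 : ℝ) ^ n)⁻¹ := by
  simp [oplus, h, sub_eq_add_neg]

lemma measurePreserving_oplus {n : ℕ} (hn : 0 < n) :
    MeasurePreserving (fun x : ℝ => oplus x n) (volume.restrict (Set.Ico (0 : ℝ) 1))
      (volume.restrict (Set.Ico (0 : ℝ) 1)) := by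
  refine ⟨measurable_oplus n, ?_⟩
  ext S hS
  rw [Measure.map_apply (measurable_oplus n) hS, Measure.restrict_apply hS,
    Measure.restrict_apply (measurable_oplus n hS)]
  set h : ℝ := ((2 : ℝ) ^ n)⁻¹ with hh
  set A : Set ℝ := Set.Ico (0 : ℝ) 1 ∩ {x | bdigit x n = 0}
  set B : Set ℝ := Set.Ico (0 : ℝ) 1 ∩ {x | bdigit x n = 1}
  have hA : MeasurableSet A :=
    measurableSet_Ico.inter (measurable_bdigit n (measurableSet_singleton 0))
  have hB : MeasurableSet B :=
    measurableSet_Ico.inter (measurable_bdigit n (measurableSet_singleton 1))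
  have hBA : ∀ x, x + h ∈ B → x ∈ A ∧ oplus x n = x + h := by
    rintro x ⟨hx, hx1⟩
    have e : oplus (x + h) n = x := by rw [oplus_of_bdigit_eq_one hx1]; ring
    have h0 : bdigit x n = 0 := by
      have := bdigit_oplus_self hx.1 n
      rw [e, hx1] at this
      exact this
    exact ⟨⟨e ▸ oplus_mem_Ico hx hn, h0⟩, oplus_of_bdigit_eq_zero h0⟩
  have hAB : ∀ x, x + -h ∈ A → x ∈ B ∧ oplus x n = x + -h := by
    rintro x ⟨hx, hx0⟩
    have e : oplus (x + -h) n = x := by rw [oplus_of_bdigit_eq_zero hx0]; ring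
    have h1 : bdigit x n = 1 := by
      have := bdigit_oplus_self hx.1 n
      rw [e, hx0] at this
      exact this
    exact ⟨⟨e ▸ oplus_mem_Ico hx hn, h1⟩, by rw [oplus_of_bdigit_eq_one h1, sub_eq_add_neg]⟩
  have hdisj : Disjoint A B := by
    rw [Set.disjoint_left]
    rintro x ⟨-, h0⟩ ⟨-, h1⟩
    simp_all
  have hpre : (fun x => oplus x n) ⁻¹' S ∩ Set.Ico 0 1 =
      (fun x => x + h) ⁻¹' (S ∩ B) ∪ (fun x => x + -h) ⁻¹' (S ∩ A) := by
    ext x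
    constructor
    · rintro ⟨hxS, hx⟩
      have hx' := oplus_mem_Ico hx hn
      have hflip := bdigit_oplus_self hx.1 n
      rw [Set.mem_preimage] at hxS
      rcases bdigit_eq_zero_or_one x n with h0 | h1
      · left
        rw [oplus_of_bdigit_eq_zero h0] at hxS hx' hflip
        exact ⟨hxS, hx', by rw [Set.mem_ofPred_eq, hflip, h0]⟩
      · right
        rw [oplus_of_bdigit_eq_one h1, sub_eq_add_neg] at hxS hx' hflip
        exact ⟨hxS, hx', by rw [Set.mem_ofPred_eq, hflip, h1]⟩
    · rintro (⟨hxS, hx⟩ | ⟨hxS, hx⟩)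
      · obtain ⟨h1, h2⟩ := hBA x hx
        exact ⟨by rw [Set.mem_preimage, h2]; exact hxS, h1.1⟩
      · obtain ⟨h1, h2⟩ := hAB x hx
        exact ⟨by rw [Set.mem_preimage, h2]; exact hxS, h1.1⟩
  have hsplit : S ∩ Set.Ico 0 1 = (S ∩ B) ∪ (S ∩ A) := by
    ext x
    have := bdigit_eq_zero_or_one x n
    simp only [A, B, Set.mem_inter_iff, Set.mem_union, Set.mem_ofPred_eq]
    tauto
  rw [hpre, hsplit, measure_union _ (measurable_add_const _ (hS.inter hA)),
    measure_union (hdisj.symm.mono Set.inter_subset_right Set.inter_subset_right) (hS.inter hA),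
    measure_preimage_add_right, measure_preimage_add_right]
  exact hdisj.mono (fun x hx => (hBA x hx.2).1) (fun x hx => (hAB x hx.2).1)

lemma walsh_eq_prod (k : ℕ) (x : ℝ) :
    walsh k x = ∏ j ∈ Finset.range k, (-1 : ℝ) ^ (if k.testBit j then bdigit x (j + 1) else 0) := by
  rw [walsh, Finset.prod_pow_eq_pow_sum]

lemma measurable_walsh (k : ℕ) : Measurable (walsh k) := by
  unfold walsh
  refine (measurable_of_countable fun m : ℕ => (-1 : ℝ) ^ m).comp
    (Finset.measurable_sum _ fun j _ => ?_)
  split_ifs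
  · exact measurable_bdigit _
  · exact measurable_const

lemma walsh_oplus {k a : ℕ} (ha : k.testBit a = true) {x : ℝ} (hx : 0 ≤ x) :
    walsh k (oplus x (a + 1)) = -walsh k x := by
  have hak : a ∈ Finset.range k :=
    Finset.mem_range.2 (a.lt_two_pow_self.trans_le (Nat.ge_two_pow_of_testBit ha))
  rw [walsh_eq_prod, walsh_eq_prod, ← Finset.mul_prod_erase _ _ hak,
    ← Finset.mul_prod_erase (Finset.range k) _ hak, ← neg_mul]
  congr 1
  · rw [if_pos ha, if_pos ha, bdigit_oplus_self hx]
    rcases bdigit_eq_zero_or_one x (a + 1) with h | h <;> simp [h]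
  · refine Finset.prod_congr rfl fun j hj => ?_
    have hne : j + 1 ≠ a + 1 := by
      simpa using (Finset.mem_erase.1 hj).1
    rw [bdigit_oplus_of_ne hx hne]

lemma measurable_walshV {s : ℕ} (k : Fin s → ℕ) : Measurable (walshV k) := by
  unfold walshV
  exact Finset.measurable_prod _ fun i _ => (measurable_walsh (k i)).comp (measurable_pi_apply i)

lemma norm_walshV {s : ℕ} (k : Fin s → ℕ) (x : Fin s → ℝ) : ‖walshV k x‖ = 1 := by
  simp [walshV, walsh, norm_prod]

lemma walshV_update_oplus {s : ℕ} {k : Fin s → ℕ} {i : Fin s} {a : ℕ}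
    (ha : (k i).testBit a = true) {x : Fin s → ℝ} (hx : 0 ≤ x i) :
    walshV k (Function.update x i (oplus (x i) (a + 1))) = -walshV k x := by
  rw [walshV, walshV, ← Finset.mul_prod_erase _ _ (Finset.mem_univ i),
    ← Finset.mul_prod_erase Finset.univ (fun j => walsh (k j) (x j)) (Finset.mem_univ i),
    ← neg_mul, Function.update_self, walsh_oplus ha hx]
  congr 1
  refine Finset.prod_congr rfl fun j hj => ?_
  rw [Function.update_of_ne (Finset.mem_erase.1 hj).1]

lemma measurableSet_unitCube (s : ℕ) : MeasurableSet (unitCube s) :=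
  MeasurableSet.univ_pi fun _ => measurableSet_Ico

lemma measurePreserving_update_oplus {s : ℕ} (i : Fin s) {n : ℕ} (hn : 0 < n) :
    MeasurePreserving (fun x : Fin s → ℝ => Function.update x i (oplus (x i) n))
      (volume.restrict (unitCube s)) (volume.restrict (unitCube s)) := by
  have hμ : (volume : Measure (Fin s → ℝ)).restrict (unitCube s) =
      Measure.pi fun _ => volume.restrict (Set.Ico (0 : ℝ) 1) := by
    rw [unitCube, volume_pi, Measure.restrict_pi_pi]
  rw [hμ]
  have h := measurePreserving_pi (fun _ : Fin s => volume.restrict (Set.Ico (0 : ℝ) 1))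
    (fun _ : Fin s => volume.restrict (Set.Ico (0 : ℝ) 1))
    (f := fun j x => if j = i then oplus x n else x) (fun j => by
      by_cases hj : j = i
      · simpa only [hj, if_true] using measurePreserving_oplus hn
      · simp only [hj, if_false]
        exact MeasurePreserving.id _)
  have hfun : (fun x : Fin s → ℝ => Function.update x i (oplus (x i) n)) =
      fun x j => if j = i then oplus (x j) n else x j := by
    funext x j
    by_cases hj : j = i
    · subst hj; simp
    · simp [hj]
  rw [hfun]
  simpa only [apply_ite] using h

lemma integrable_mul_walshV {s : ℕ} (k : Fin s → ℕ) {g : (Fin s → ℝ) → ℝ}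
    (hg : IntegrableOn g (unitCube s)) : IntegrableOn (fun x => g x * walshV k x) (unitCube s) :=
  hg.mul_bdd (c := 1) (measurable_walshV k).aestronglyMeasurable
    (Filter.Eventually.of_forall fun x => (norm_walshV k x).le)

lemma integrableOn_comp_update_oplus {s : ℕ} (i : Fin s) {n : ℕ} (hn : 0 < n)
    {g : (Fin s → ℝ) → ℝ} (hg : IntegrableOn g (unitCube s)) :
    IntegrableOn (fun x => g (Function.update x i (oplus (x i) n))) (unitCube s) :=
  (measurePreserving_update_oplus i hn).integrable_comp_of_integrable hg

lemma integrableOn_dyadicDiff {s : ℕ} (i : Fin s) {n : ℕ} (hn : 0 < n)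
    {g : (Fin s → ℝ) → ℝ} (hg : IntegrableOn g (unitCube s)) :
    IntegrableOn (dyadicDiff i n g) (unitCube s) :=
  ((integrableOn_comp_update_oplus i hn hg).sub hg).const_mul _

lemma walshCoeff_comp_update_oplus {s : ℕ} {k : Fin s → ℕ} {i : Fin s} {a : ℕ}
    (ha : (k i).testBit a = true) {g : (Fin s → ℝ) → ℝ} (hg : IntegrableOn g (unitCube s)) :
    walshCoeff (fun x => g (Function.update x i (oplus (x i) (a + 1)))) k = -walshCoeff g k := by
  have hT := measurePreserving_update_oplus i a.succ_pos
  have h1 : ∫ x in unitCube s, g (Function.update x i (oplus (x i) (a + 1))) *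
      walshV k (Function.update x i (oplus (x i) (a + 1))) = walshCoeff g k := by
    have h2 := integral_map (f := fun x => g x * walshV k x) hT.measurable.aemeasurable
      (by rw [hT.map_eq]; exact (integrable_mul_walshV k hg).aestronglyMeasurable)
    rw [hT.map_eq] at h2
    exact h2.symm
  rw [← h1, walshCoeff, ← integral_neg]
  refine setIntegral_congr_fun (measurableSet_unitCube s) fun x hx => ?_
  rw [walshV_update_oplus ha (hx i (Set.mem_univ i)).1]
  ring

lemma walshCoeff_dyadicDiff {s : ℕ} {k : Fin s → ℕ} {i : Fin s} {a : ℕ}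
    (ha : (k i).testBit a = true) {g : (Fin s → ℝ) → ℝ} (hg : IntegrableOn g (unitCube s)) :
    walshCoeff (dyadicDiff i (a + 1) g) k = -(2 ^ (a + 2) * walshCoeff g k) := by
  have h1 : walshCoeff (dyadicDiff i (a + 1) g) k = 2 ^ (a + 1) *
      (walshCoeff (fun x => g (Function.update x i (oplus (x i) (a + 1)))) k -
        walshCoeff g k) := by
    unfold walshCoeff
    rw [← integral_sub (integrable_mul_walshV k (integrableOn_comp_update_oplus i a.succ_pos hg))
      (integrable_mul_walshV k hg), ← integral_const_mul]
    refine integral_congr_ae (Filter.Eventually.of_forall fun x => ?_)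
    simp only [dyadicDiff]
    ring
  rw [h1, walshCoeff_comp_update_oplus ha hg]
  ring

lemma walshCoeff_dCompCoord {s : ℕ} {k : Fin s → ℕ} {i : Fin s} {L : List ℕ}
    (hL : ∀ a ∈ L, (k i).testBit a = true) {g : (Fin s → ℝ) → ℝ}
    (hg : IntegrableOn g (unitCube s)) :
    IntegrableOn (dCompCoord i L g) (unitCube s) ∧
      walshCoeff g k = (-1 : ℝ) ^ L.length * ((2 : ℝ) ^ (L.map (· + 2)).sum)⁻¹ *
        walshCoeff (dCompCoord i L g) k := by
  induction L with
  | nil => exact ⟨hg, by simp [dCompCoord]⟩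
  | cons a L ih =>
    obtain ⟨h1, h2⟩ := ih fun b hb => hL b (List.mem_cons_of_mem a hb)
    refine ⟨integrableOn_dyadicDiff i a.succ_pos h1, ?_⟩
    change _ = _ * walshCoeff (dyadicDiff i (a + 1) (dCompCoord i L g)) k
    rw [walshCoeff_dyadicDiff (hL a List.mem_cons_self) h1, h2, List.length_cons, List.map_cons,
      List.sum_cons, pow_succ, pow_add _ (a + 2)]
    field_simp

lemma testBit_of_mem_bitsDesc {k a : ℕ} (ha : a ∈ bitsDesc k) : k.testBit a = true := by
  simp only [bitsDesc, List.mem_reverse, List.mem_filter] at ha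
  exact ha.2

lemma walshCoeff_foldr_dCompCoord {s : ℕ} (k u : Fin s → ℕ) {f : (Fin s → ℝ) → ℝ}
    (hf : IntegrableOn f (unitCube s)) (l : List (Fin s)) :
    IntegrableOn (l.foldr (fun i g => dCompCoord i ((bitsDesc (k i)).take (u i)) g) f)
        (unitCube s) ∧
      walshCoeff f k = (-1 : ℝ) ^ (l.map fun i => min (u i) (numBits (k i))).sum *
        ((2 : ℝ) ^ (l.map fun i => muW (u i) (k i)).sum)⁻¹ *
        walshCoeff (l.foldr (fun i g => dCompCoord i ((bitsDesc (k i)).take (u i)) g) f) k := by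
  induction l with
  | nil => exact ⟨hf, by simp⟩
  | cons i l ih =>
    obtain ⟨h1, h2⟩ := ih
    obtain ⟨h3, h4⟩ := walshCoeff_dCompCoord (k := k) (i := i)
      (L := (bitsDesc (k i)).take (u i))
      (fun a ha => testBit_of_mem_bitsDesc (List.mem_of_mem_take ha)) h1
    refine ⟨h3, ?_⟩
    rw [h2, h4, List.foldr_cons, List.map_cons, List.map_cons, List.sum_cons, List.sum_cons,
      List.length_take, muW, numBits, pow_add, pow_add, mul_inv]
    ring

/-- Lemma `disc_id`: for `f ∈ L¹([0,1)^s)`,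
`d_{k_u} f ∈ L¹([0,1)^s)` and
`f̂(k) = (-1)^{∑ᵢ min(u_i,N_i)} ⋅ 2^{-μ'_u(k)} ⋅ (d_{k_u} f)^̂(k)`. -/
theorem stmt3 {s : ℕ} (hs : 1 ≤ s) (f : (Fin s → ℝ) → ℝ)
    (hf : IntegrableOn f (unitCube s))
    (k u : Fin s → ℕ) (hu : ∀ i, 1 ≤ u i) :
    IntegrableOn (dComp u k f) (unitCube s) ∧
      walshCoeff f k =
        (-1 : ℝ) ^ (∑ i, min (u i) (numBits (k i))) * ((2 : ℝ) ^ muWV u k)⁻¹ *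
          walshCoeff (dComp u k f) k := by
  simpa only [dComp, muWV, Fin.sum_univ_def] using
    walshCoeff_foldr_dCompCoord k u hf (List.finRange s)

end
end

section
/- Let n, s, i ∈ ℕ with i ≤ s, and let g : [0,1]^s → ℝ be such that, as a function of its i-th coordinate x_i (with the other coordinates fixed), g is continuously differentiable on each half-open interval [2^{−n+1}c, 2^{−n+1}(c+1)) for c = 0,…,2^{n−1}−1; let (∂g/∂x_i)* denote the function equal to this derivative on each such interval. Then for every z = (z₁,…,z_s) ∈ [0,1)^s, wal_{2^{n−1}}(z_i) · ∂_{i,n}(g)(z) = ∫₀¹ (∂g/∂x_i)*(z₁,…,z_{i−1}, y, z_{i+1},…,z_s) · χ_n(z_i, y) dy. -/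
open MeasureTheory Finset
open scoped ENNReal

noncomputable section

lemma walsh_two_pow (m : ℕ) (x : ℝ) : walsh (2 ^ m) x = (-1) ^ bdigit x (m + 1) := by
  unfold walsh
  simp [Nat.testBit_two_pow, Finset.sum_ite_eq, Nat.lt_two_pow_self]

/-- `x` and `x ⊕ 2^{-n}` lie in a common dyadic interval of length `2^{1-n}`. -/
lemma exists_dyadic_mem_oplus_mem {n : ℕ} (hn : 1 ≤ n) {x : ℝ} (hx : x ∈ Set.Ico (0 : ℝ) 1) :
    ∃ c : ℕ, c < 2 ^ (n - 1) ∧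
      x ∈ Set.Ico ((c : ℝ) * (2 : ℝ) ^ (1 - (n : ℤ))) (((c : ℝ) + 1) * (2 : ℝ) ^ (1 - (n : ℤ))) ∧
      oplus x n ∈
        Set.Ico ((c : ℝ) * (2 : ℝ) ^ (1 - (n : ℤ))) (((c : ℝ) + 1) * (2 : ℝ) ^ (1 - (n : ℤ))) := by
  have hp : (0 : ℝ) < 2 ^ n := by positivity
  have hy : 0 ≤ x * 2 ^ n := mul_nonneg hx.1 hp.le
  have hdig : bdigit x n = ⌊x * 2 ^ n⌋₊ % 2 := by rw [bdigit, Int.floor_toNat]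
  have hle := Nat.floor_le hy
  have hlt := Nat.lt_floor_add_one (x * 2 ^ n)
  have hm : ⌊x * 2 ^ n⌋₊ < 2 ^ n := by
    rw [Nat.floor_lt hy]
    push_cast
    nlinarith [hx.2]
  set m := ⌊x * 2 ^ n⌋₊
  have hh : (2 : ℝ) ^ (1 - (n : ℤ)) = 2 / 2 ^ n := by
    rw [zpow_sub₀ two_ne_zero, zpow_one, zpow_natCast]
  have hn2 : 2 ^ n = 2 * 2 ^ (n - 1) := by
    rw [← pow_succ', Nat.sub_add_cancel hn]
  have hmem (t : ℝ) : t ∈ Set.Ico (((m / 2 : ℕ) : ℝ) * (2 : ℝ) ^ (1 - (n : ℤ)))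
      ((((m / 2 : ℕ) : ℝ) + 1) * (2 : ℝ) ^ (1 - (n : ℤ))) ↔
      2 * ((m / 2 : ℕ) : ℝ) ≤ t * 2 ^ n ∧ t * 2 ^ n < 2 * ((m / 2 : ℕ) : ℝ) + 2 := by
    rw [hh, Set.mem_Ico, ← mul_div_assoc, ← mul_div_assoc, div_le_iff₀ hp, lt_div_iff₀ hp]
    ring_nf
  have hop : oplus x n * 2 ^ n = x * 2 ^ n + (-1) ^ (m % 2) := by
    rw [oplus, hdig, add_mul, mul_assoc, inv_mul_cancel₀ hp.ne', mul_one]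
  have hdm : (2 * ((m / 2 : ℕ) : ℝ)) + ((m % 2 : ℕ) : ℝ) = m := by
    exact_mod_cast Nat.div_add_mod m 2
  refine ⟨m / 2, by omega, (hmem _).2 ?_, (hmem _).2 ?_⟩
  · rcases Nat.mod_two_eq_zero_or_one m with h | h <;> rw [h] at hdm <;> push_cast at hdm <;>
      constructor <;> linarith
  · rw [hop]
    rcases Nat.mod_two_eq_zero_or_one m with h | h <;> rw [h] at hdm ⊢ <;> push_cast at hdm <;>
      constructor <;> linarith

lemma integral_derivWithin_Ico_eq_sub {f : ℝ → ℝ} {p q a b : ℝ}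
    (hf : ContDiffOn ℝ 1 f (Set.Ico p q)) (hab : a ≤ b) (hsub : Set.Icc a b ⊆ Set.Ico p q) :
    ∫ y in a..b, derivWithin f (Set.Ico p q) y = f b - f a := by
  refine intervalIntegral.integral_eq_sub_of_hasDerivAt_of_le hab (hf.continuousOn.mono hsub)
    (fun y hy => ?_) ?_
  · have hy' := hsub ⟨hy.1.le, hy.2.le⟩
    have hpy : p < y := (hsub (Set.left_mem_Icc.2 hab)).1.trans_lt hy.1
    exact ((hf.differentiableOn one_ne_zero y hy').hasDerivWithinAt).hasDerivAt
      (Ico_mem_nhds hpy hy'.2)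
  · apply ContinuousOn.intervalIntegrable
    rw [Set.uIcc_of_le hab]
    exact (hf.continuousOn_derivWithin (uniqueDiffOn_Ico p q) le_rfl).mono hsub

lemma chi_eq_indicator (n : ℕ) (x y : ℝ) :
    chi n x y = (Set.uIcc x (oplus x n)).indicator (fun _ => (2 : ℝ) ^ n) y := by
  simp [chi, Set.indicator_apply, Set.uIcc, Set.mem_Icc]

lemma dyadic_Ico_subset_unit {n : ℕ} (hn : 1 ≤ n) {c : ℕ} (hc : c < 2 ^ (n - 1)) :
    Set.Ico ((c : ℝ) * (2 : ℝ) ^ (1 - (n : ℤ))) (((c : ℝ) + 1) * (2 : ℝ) ^ (1 - (n : ℤ))) ⊆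
      Set.Ico 0 1 := by
  refine Set.Ico_subset_Ico (by positivity) ?_
  have h1 : (2 : ℝ) ^ (1 - (n : ℤ)) = (2 ^ (n - 1))⁻¹ := by
    rw [← zpow_natCast, ← zpow_neg]
    congr 1
    omega
  have h2 : (c : ℝ) + 1 ≤ 2 ^ (n - 1) := by exact_mod_cast hc
  rw [h1]
  exact mul_inv_le_one_of_le₀ h2 (by positivity)

/-- Lemma `chi`: if `g`, as a function of its `i`-th coordinate, is `C¹`
on each interval `[2^{-n+1}c, 2^{-n+1}(c+1))`, and `g*` equals this derivative on each
such interval, then for `z ∈ [0,1)^s`,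
`wal_{2^{n-1}}(z_i) ⋅ ∂_{i,n}(g)(z) = ∫₀¹ g*(…,y,…) χ_n(z_i, y) dy`. -/
theorem stmt6 {s : ℕ} (n : ℕ) (hn : 1 ≤ n) (i : Fin s)
    (g gstar : (Fin s → ℝ) → ℝ)
    (hg : ∀ x : Fin s → ℝ, x ∈ unitCube s → ∀ c : ℕ, c < 2 ^ (n - 1) →
      ContDiffOn ℝ 1 (fun t => g (Function.update x i t))
        (Set.Ico ((c : ℝ) * (2 : ℝ) ^ (1 - (n : ℤ))) (((c : ℝ) + 1) * (2 : ℝ) ^ (1 - (n : ℤ)))))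
    (hgstar : ∀ x : Fin s → ℝ, x ∈ unitCube s → ∀ c : ℕ, c < 2 ^ (n - 1) →
      x i ∈ Set.Ico ((c : ℝ) * (2 : ℝ) ^ (1 - (n : ℤ)))
        (((c : ℝ) + 1) * (2 : ℝ) ^ (1 - (n : ℤ))) →
      gstar x = derivWithin (fun t => g (Function.update x i t))
        (Set.Ico ((c : ℝ) * (2 : ℝ) ^ (1 - (n : ℤ))) (((c : ℝ) + 1) * (2 : ℝ) ^ (1 - (n : ℤ))))
        (x i)) :
    ∀ z ∈ unitCube s,
      walsh (2 ^ (n - 1)) (z i) * dyadicDiff i n g z =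
        ∫ y in Set.Ico (0 : ℝ) 1, gstar (Function.update z i y) * chi n (z i) y := by
  intro z hz
  have hzi : ∀ j, z j ∈ Set.Ico (0 : ℝ) 1 := fun j => hz j (Set.mem_univ j)
  obtain ⟨c, hc, hx, hx'⟩ := exists_dyadic_mem_oplus_mem hn (hzi i)
  have hunit := dyadic_Ico_subset_unit hn hc
  have hf := hg z hz c hc
  set J := Set.Ico ((c : ℝ) * (2 : ℝ) ^ (1 - (n : ℤ))) (((c : ℝ) + 1) * (2 : ℝ) ^ (1 - (n : ℤ)))
    with hJ
  set f : ℝ → ℝ := fun t => g (Function.update z i t) with hfdef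
  have hsub : Set.uIcc (z i) (oplus (z i) n) ⊆ J := Set.ordConnected_Ico.uIcc_subset hx hx'
  have hstar : ∀ y ∈ J, gstar (Function.update z i y) = derivWithin f J y := by
    intro y hy
    have hmem : Function.update z i y ∈ unitCube s := by
      intro j _
      rcases eq_or_ne j i with rfl | hj
      · simpa using hunit hy
      · simpa [hj] using hzi j
    simpa [hfdef, hJ] using hgstar _ hmem c hc (by rwa [Function.update_self])
  have hfz : g z = f (z i) := by simp [hfdef]
  have hR : ∫ y in Set.Ico (0 : ℝ) 1, gstar (Function.update z i y) * chi n (z i) y =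
      2 ^ n * ∫ y in Set.uIcc (z i) (oplus (z i) n), derivWithin f J y := by
    simp_rw [chi_eq_indicator, ← Set.indicator_mul_right _ (fun y => gstar (Function.update z i y))]
    rw [setIntegral_indicator measurableSet_uIcc,
      Set.inter_eq_self_of_subset_right (hsub.trans hunit), integral_mul_const, mul_comm]
    congr 1
    exact setIntegral_congr_fun measurableSet_uIcc fun y hy => hstar y (hsub hy)
  have hwalsh : walsh (2 ^ (n - 1)) (z i) = (-1) ^ bdigit (z i) n := by
    rw [walsh_two_pow, Nat.sub_add_cancel hn]
  rw [hR, hwalsh, dyadicDiff, hfz]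
  change _ * (2 ^ n * (f (oplus (z i) n) - f (z i))) = _
  have hpos : (0 : ℝ) < (2 ^ n)⁻¹ := by positivity
  rcases neg_one_pow_eq_or ℝ (bdigit (z i) n) with h | h
  · have hle : z i ≤ oplus (z i) n := by rw [oplus, h]; linarith
    rw [Set.uIcc_of_le hle] at hsub ⊢
    rw [integral_Icc_eq_integral_Ioc, ← intervalIntegral.integral_of_le hle,
      integral_derivWithin_Ico_eq_sub hf hle hsub, h, one_mul]
  · have hle : oplus (z i) n ≤ z i := by rw [oplus, h]; linarith
    rw [Set.uIcc_of_ge hle] at hsub ⊢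
    rw [integral_Icc_eq_integral_Ioc, ← intervalIntegral.integral_of_le hle,
      integral_derivWithin_Ico_eq_sub hf hle hsub, h]
    ring

end
end

section
/- Let n ∈ ℕ and let c ∈ ℕ₀ with c < 2^{n−1}. Then for all x, y ∈ [0, 2^{−n+1}), χ_n(x + c·2^{−n+1}, y + c·2^{−n+1}) = χ_n(x, y). -/
open MeasureTheory Finset
open scoped ENNReal

noncomputable section

/-- Translating `x ≥ 0` by a multiple of `2^{1-n}` does not change its `n`-th binary digit. -/
theorem bdigit_add_natCast_mul {x : ℝ} (hx : 0 ≤ x) (n c : ℕ) :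
    bdigit (x + c * (2 : ℝ) ^ (1 - (n : ℤ))) n = bdigit x n := by
  have hmul : (x + c * (2 : ℝ) ^ (1 - (n : ℤ))) * 2 ^ n = x * 2 ^ n + ((2 * c : ℕ) : ℝ) := by
    rw [zpow_sub₀ two_ne_zero, zpow_one, zpow_natCast]
    push_cast
    field_simp
  have hfloor : 0 ≤ ⌊x * 2 ^ n⌋ := Int.floor_nonneg.2 (by positivity)
  unfold bdigit
  rw [hmul, Int.floor_add_natCast]
  omega

theorem oplus_add_natCast_mul {x : ℝ} (hx : 0 ≤ x) (n c : ℕ) :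
    oplus (x + c * (2 : ℝ) ^ (1 - (n : ℤ))) n = oplus x n + c * (2 : ℝ) ^ (1 - (n : ℤ)) := by
  rw [oplus, oplus, bdigit_add_natCast_mul hx, add_right_comm]

theorem chi_add_natCast_mul {x : ℝ} (hx : 0 ≤ x) (y : ℝ) (n c : ℕ) :
    chi n (x + c * (2 : ℝ) ^ (1 - (n : ℤ))) (y + c * (2 : ℝ) ^ (1 - (n : ℤ))) = chi n x y := by
  simp only [chi, oplus_add_natCast_mul hx, min_add_add_right, max_add_add_right,
    add_le_add_iff_right]

/-- Lemma `period_chi`, item 1: for `c < 2^{n-1}` and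
`x, y ∈ [0, 2^{-n+1})`, `χ_n(x + c⋅2^{-n+1}, y + c⋅2^{-n+1}) = χ_n(x,y)`. -/
theorem stmt9 (n : ℕ) (hn : 1 ≤ n) (c : ℕ) (hc : c < 2 ^ (n - 1)) :
    ∀ x ∈ Set.Ico (0 : ℝ) ((2 : ℝ) ^ (1 - (n : ℤ))),
      ∀ y ∈ Set.Ico (0 : ℝ) ((2 : ℝ) ^ (1 - (n : ℤ))),
        chi n (x + (c : ℝ) * (2 : ℝ) ^ (1 - (n : ℤ)))
            (y + (c : ℝ) * (2 : ℝ) ^ (1 - (n : ℤ))) =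
          chi n x y := by
  exact fun x hx y _ => chi_add_natCast_mul hx.1 y n c

end
end

section
/- Let k ∈ ℕ have binary expansion k = ∑_{j=1}^N 2^{a_j} with a₁ > ⋯ > a_N ≥ 0. Then W(k) is periodic with period 2^{−a_N}: for every integer c with 0 ≤ c < 2^{a_N} and every y ∈ [0, 2^{−a_N}), W(k)(y + c·2^{−a_N}) = W(k)(y). -/
open MeasureTheory Finset
open scoped ENNReal

noncomputable section

/-- Translating a nonnegative `x` by a multiple of `2^{-a}` keeps its digit of index `a + 1`. -/
lemma bdigit_add_div_two_pow {a : ℕ} {x : ℝ} (c : ℕ) (hx : 0 ≤ x) :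
    bdigit (x + c * ((2 : ℝ) ^ a)⁻¹) (a + 1) = bdigit x (a + 1) := by
  have h : (x + c * ((2 : ℝ) ^ a)⁻¹) * 2 ^ (a + 1) = x * 2 ^ (a + 1) + ((2 * c : ℕ) : ℝ) := by
    push_cast
    field_simp
    ring
  have hf : 0 ≤ ⌊x * 2 ^ (a + 1)⌋ := Int.floor_nonneg.2 (by positivity)
  unfold bdigit
  rw [h, Int.floor_add_natCast]
  omega

lemma chi_add_div_two_pow {a : ℕ} {x : ℝ} (y : ℝ) (c : ℕ) (hx : 0 ≤ x) :
    chi (a + 1) (x + c * ((2 : ℝ) ^ a)⁻¹) (y + c * ((2 : ℝ) ^ a)⁻¹) = chi (a + 1) x y := by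
  have h : oplus (x + c * ((2 : ℝ) ^ a)⁻¹) (a + 1) = oplus x (a + 1) + c * ((2 : ℝ) ^ a)⁻¹ := by
    unfold oplus
    rw [bdigit_add_div_two_pow c hx]
    ring
  unfold chi
  rw [h, min_add_add_right, max_add_add_right]
  simp only [add_le_add_iff_right]

/-- `χ_{a+1}(x, y)` vanishes unless `x` and `y` lie in the same dyadic interval of length
`2^{-a}`. -/
lemma chi_eq_zero_of_floor_ne {a : ℕ} {x y : ℝ} (hx : 0 ≤ x)
    (h : ⌊x * 2 ^ a⌋ ≠ ⌊y * 2 ^ a⌋) : chi (a + 1) x y = 0 := by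
  unfold chi
  rw [if_neg]
  rintro ⟨h1, h2⟩
  apply h
  have hp : (0 : ℝ) < 2 ^ a := by positivity
  set m := ⌊x * 2 ^ (a + 1)⌋ with hm
  have hm0 : 0 ≤ m := Int.floor_nonneg.2 (by positivity)
  have hml : (m : ℝ) ≤ x * 2 ^ a * 2 := by
    have := Int.floor_le (x * 2 ^ (a + 1))
    rw [← hm] at this
    rwa [pow_succ, ← mul_assoc] at this
  have hmu : x * 2 ^ a * 2 < m + 1 := by
    have := Int.lt_floor_add_one (x * 2 ^ (a + 1))
    rw [← hm] at this
    rwa [pow_succ, ← mul_assoc] at this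
  have hq : ((2 : ℝ) ^ (a + 1))⁻¹ * 2 ^ a * 2 = 1 := by
    field_simp
    ring
  have hqp : (0 : ℝ) < ((2 : ℝ) ^ (a + 1))⁻¹ := by positivity
  set e := ⌊y * 2 ^ a⌋ with he
  have hel : (e : ℝ) ≤ y * 2 ^ a := Int.floor_le _
  have heu : y * 2 ^ a < e + 1 := Int.lt_floor_add_one _
  rw [Int.floor_eq_iff]
  have hcase : m.toNat % 2 = 0 ∨ m.toNat % 2 = 1 := by omega
  have hb : bdigit x (a + 1) = m.toNat % 2 := rfl
  unfold oplus at h1 h2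
  rw [hb] at h1 h2
  rcases hcase with hc | hc
  · rw [hc, pow_zero, one_mul, min_eq_left (by linarith)] at h1
    rw [hc, pow_zero, one_mul, max_eq_right (by linarith)] at h2
    have h1' := mul_le_mul_of_nonneg_right h1 hp.le
    have h2' := mul_le_mul_of_nonneg_right h2 hp.le
    have : 2 * e - 2 < m := by
      have : (2 * e - 2 : ℝ) < m := by linarith
      exact_mod_cast this
    have : 2 * e ≤ m := by omega
    have : (2 * e : ℝ) ≤ m := by exact_mod_cast this
    constructor <;> linarith
  · rw [hc, pow_one, min_eq_right (by linarith)] at h1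
    rw [hc, pow_one, max_eq_left (by linarith)] at h2
    have h1' := mul_le_mul_of_nonneg_right h1 hp.le
    have h2' := mul_le_mul_of_nonneg_right h2 hp.le
    have : m < 2 * e + 3 := by
      have : (m : ℝ) < 2 * e + 3 := by linarith
      exact_mod_cast this
    have : m + 1 ≤ 2 * e + 2 := by omega
    have : (m + 1 : ℝ) ≤ 2 * e + 2 := by exact_mod_cast this
    constructor <;> linarith

/-- If `g` has period `2^{-a}` on `[0,1)`, then so has `y ↦ ∫ χ_{a+1}(x, y) g(x) dx`. -/
lemma integral_chi_mul_periodic {a : ℕ} {g : ℝ → ℝ}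
    (hg : ∀ c : ℕ, ∀ x : ℝ, 0 ≤ x → x + c * ((2 : ℝ) ^ a)⁻¹ < 1 →
      g (x + c * ((2 : ℝ) ^ a)⁻¹) = g x)
    (c : ℕ) {y : ℝ} (hy : 0 ≤ y) (hyc : y + c * ((2 : ℝ) ^ a)⁻¹ < 1) :
    ∫ x in Set.Ico (0 : ℝ) 1, chi (a + 1) x (y + c * ((2 : ℝ) ^ a)⁻¹) * g x =
      ∫ x in Set.Ico (0 : ℝ) 1, chi (a + 1) x y * g x := by
  have hp : (0 : ℝ) < 2 ^ a := by positivity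
  have hshift : ∀ z : ℝ, (z + c * ((2 : ℝ) ^ a)⁻¹) * 2 ^ a = z * 2 ^ a + c := by
    intro z
    field_simp
  have ht : (0 : ℝ) ≤ c * ((2 : ℝ) ^ a)⁻¹ := by positivity
  rw [← integral_indicator measurableSet_Ico, ← integral_indicator measurableSet_Ico,
    ← integral_add_right_eq_self _ ((c : ℝ) * ((2 : ℝ) ^ a)⁻¹)]
  congr 1
  ext x
  by_cases hxy : ⌊x * 2 ^ a⌋ = ⌊y * 2 ^ a⌋
  · set e := ⌊y * 2 ^ a⌋ with he
    have he0 : 0 ≤ e := Int.floor_nonneg.2 (by positivity)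
    have hx0 : 0 ≤ x := by
      have h : (0 : ℝ) ≤ x * 2 ^ a := Int.floor_nonneg.1 (hxy ▸ he0)
      exact nonneg_of_mul_nonneg_left h hp
    have hec : e + c + 1 ≤ 2 ^ a := by
      have h1 := mul_lt_mul_of_pos_right hyc hp
      rw [hshift] at h1
      have h2 : (e : ℝ) ≤ y * 2 ^ a := Int.floor_le _
      have h3 : ((e : ℝ) + c) < 2 ^ a := by linarith
      have h4 : e + c < 2 ^ a := by exact_mod_cast h3
      omega
    have hxc : x + c * ((2 : ℝ) ^ a)⁻¹ < 1 := by
      have h1 : x * 2 ^ a < e + 1 := hxy ▸ Int.lt_floor_add_one (x * 2 ^ a)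
      have h2 : ((e : ℝ) + c + 1) ≤ 2 ^ a := by exact_mod_cast hec
      refine lt_of_mul_lt_mul_right ?_ hp.le
      rw [hshift]
      linarith
    rw [Set.indicator_of_mem (Set.mem_Ico.2 ⟨by linarith, hxc⟩),
      Set.indicator_of_mem (Set.mem_Ico.2 ⟨hx0, by linarith⟩),
      chi_add_div_two_pow y c hx0, hg c x hx0 hxc]
  · trans (0 : ℝ)
    · refine Set.indicator_apply_eq_zero.2 fun hx => ?_
      rw [chi_eq_zero_of_floor_ne hx.1, zero_mul]
      rw [hshift, hshift, Int.floor_add_natCast, Int.floor_add_natCast]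
      omega
    · refine (Set.indicator_apply_eq_zero.2 fun hx => ?_).symm
      rw [chi_eq_zero_of_floor_ne hx.1 hxy, zero_mul]

/-- If `2^a` divides `k`, then `W(k)` has period `2^{-a}` on `[0,1)`. -/
lemma Wfun_periodic (k : ℕ) : ∀ a : ℕ, 2 ^ a ∣ k → ∀ c : ℕ, ∀ y : ℝ, 0 ≤ y →
    y + c * ((2 : ℝ) ^ a)⁻¹ < 1 → Wfun k (y + c * ((2 : ℝ) ^ a)⁻¹) = Wfun k y := by
  induction k using Nat.strong_induction_on with
  | _ k ih =>
    rcases k with _ | k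
    · intros
      simp [Wfun]
    intro a ha c y hy hyc
    set v := (k + 1).factorization 2 with hv
    have hdvd : 2 ^ v ∣ k + 1 := Nat.ordProj_dvd (k + 1) 2
    have hav : a ≤ v := (Nat.prime_two.pow_dvd_iff_le_factorization (by omega)).1 ha
    have hstep : (c : ℝ) * ((2 : ℝ) ^ a)⁻¹ = ((c * 2 ^ (v - a) : ℕ) : ℝ) * ((2 : ℝ) ^ v)⁻¹ := by
      obtain ⟨d, hd⟩ := Nat.exists_eq_add_of_le hav
      rw [hd, Nat.add_sub_cancel_left, pow_add]
      push_cast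
      field_simp
    rw [hstep] at hyc ⊢
    simp only [Wfun]
    exact integral_chi_mul_periodic
      (ih _ (Nat.sub_lt (Nat.succ_pos k) (Nat.two_pow_pos _)) v
        (Nat.dvd_sub hdvd (dvd_refl _))) _ hy hyc

/-- Lemma `period_W`: `W(k)` is periodic with period `2^{-a_N}`,
where `a_N` (the least exponent in the binary expansion of `k`) is the 2-adic
valuation of `k`. -/
theorem stmt12 (k : ℕ) (hk : 1 ≤ k) :
    ∀ c : ℕ, c < 2 ^ (k.factorization 2) →
      ∀ y ∈ Set.Ico (0 : ℝ) (((2 : ℝ) ^ (k.factorization 2))⁻¹),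
        Wfun k (y + (c : ℝ) * ((2 : ℝ) ^ (k.factorization 2))⁻¹) = Wfun k y := by
  intro c hc y hy
  refine Wfun_periodic k _ (Nat.ordProj_dvd k 2) c y hy.1 ?_
  have hp : (0 : ℝ) < 2 ^ k.factorization 2 := by positivity
  have hc' : (c : ℝ) + 1 ≤ 2 ^ k.factorization 2 := by exact_mod_cast hc
  calc y + c * ((2 : ℝ) ^ k.factorization 2)⁻¹
      < ((c : ℝ) + 1) * ((2 : ℝ) ^ k.factorization 2)⁻¹ := by linarith [hy.2]
    _ ≤ 2 ^ k.factorization 2 * ((2 : ℝ) ^ k.factorization 2)⁻¹ := by gcongr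
    _ = 1 := mul_inv_cancel₀ hp.ne'

end
end
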